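/- There exists a constant C > 0 such that for all real numbers x ≥ z ≥ 3, Ψ(x, z) ≤ C·(x·u^{−u} + √x), where u := log x / log z. -/

import Mathlib

open Real

/-- `Psi X z` : the number of positive integers `n ≤ X` all of whose prime factors
are `≤ z` (the number of `z`-friable integers up to `X`). -/
noncomputable def Psi (X z : ℝ) : ℕ :=
  Nat.card {n : ℕ // 0 < n ∧ (n : ℝ) ≤ X ∧ ∀ p : ℕ, p.Prime → p ∣ n → (p : ℝ) ≤ z}

/-- The completely multiplicative function `n ↦ n ^ (-s)` on the natural numbers. -/
noncomputable def rpowNegHom (s : ℝ) : ℕ →* ℝ where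
  toFun n := (n : ℝ) ^ (-s)
  map_one' := by simp
  map_mul' m n := by
    rw [Nat.cast_mul, Real.mul_rpow (Nat.cast_nonneg m) (Nat.cast_nonneg n)]

lemma hasSum_smoothNumbers_rpow_neg {s : ℝ} (hs : 0 < s) (N : ℕ) :
    HasSum (fun m : (N + 1).smoothNumbers ↦ ((m : ℕ) : ℝ) ^ (-s))
      (∏ p ∈ N.primesLE, (1 - (p : ℝ) ^ (-s))⁻¹) := by
  refine (EulerProduct.summable_and_hasSum_smoothNumbers_prod_primesBelow_geometric
    (f := rpowNegHom s) (fun {p} hp ↦ ?_) (N + 1)).2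
  change ‖(p : ℝ) ^ (-s)‖ < 1
  rw [Real.norm_of_nonneg (by positivity)]
  exact Real.rpow_lt_one_of_one_lt_of_neg (by exact_mod_cast hp.one_lt) (by linarith)

lemma sum_rpow_neg_le_prod {s : ℝ} (hs : 0 < s) {N : ℕ} {A : Finset ℕ}
    (hA : ∀ m ∈ A, m ∈ (N + 1).smoothNumbers) :
    ∑ m ∈ A, (m : ℝ) ^ (-s) ≤ ∏ p ∈ N.primesLE, (1 - (p : ℝ) ^ (-s))⁻¹ := by
  have h := sum_le_hasSum (A.subtype (· ∈ (N + 1).smoothNumbers)) (fun m _ ↦ by positivity)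
    (hasSum_smoothNumbers_rpow_neg hs N)
  rwa [Finset.sum_subtype_of_mem (fun m : ℕ ↦ (m : ℝ) ^ (-s)) hA] at h

lemma rpow_neg_le_sub_div {s : ℝ} (hs : 1 < s) {n : ℝ} (hn : 1 ≤ n) :
    (n + 1) ^ (-s) ≤ (n ^ (1 - s) - (n + 1) ^ (1 - s)) / (s - 1) := by
  have hn0 : 0 < n := by linarith
  have hm : 0 < n + 1 := by linarith
  have h1 : 1 + (s - 1) / (n + 1) ≤ (n / (n + 1)) ^ (1 - s) := by
    rw [rpow_def_of_pos (by positivity)]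
    have h2 := log_le_sub_one_of_pos (x := n / (n + 1)) (by positivity)
    have h3 : n / (n + 1) - 1 = -(1 / (n + 1)) := by field_simp; ring
    have h4 := add_one_le_exp (log (n / (n + 1)) * (1 - s))
    have h5 := mul_le_mul_of_nonneg_right (h2.trans_eq h3) (by linarith : 0 ≤ s - 1)
    have h6 : (s - 1) / (n + 1) = 1 / (n + 1) * (s - 1) := by ring
    linarith
  rw [div_rpow hn0.le hm.le, le_div_iff₀ (by positivity)] at h1
  rw [le_div_iff₀ (by linarith)]
  have e : (n + 1) ^ (1 - s) = (n + 1) * (n + 1) ^ (-s) := by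
    rw [← rpow_one_add' hm.le (by linarith)]; ring_nf
  have e2 : (1 + (s - 1) / (n + 1)) * (n + 1) ^ (1 - s) =
      (n + 1) ^ (1 - s) + (s - 1) * (n + 1) ^ (-s) := by
    rw [e]; field_simp
  linarith

lemma sum_Icc_rpow_neg_le {s : ℝ} (hs : 1 < s) (N : ℕ) :
    ∑ n ∈ Finset.Icc 1 (N + 1), (n : ℝ) ^ (-s) ≤
      1 + (1 - ((N : ℝ) + 1) ^ (1 - s)) / (s - 1) := by
  induction N with
  | zero => simp
  | succ N ih =>
    rw [Finset.sum_Icc_succ_top (by omega)]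
    have h := rpow_neg_le_sub_div hs (n := (N : ℝ) + 1) (by linarith [Nat.cast_nonneg (α := ℝ) N])
    push_cast at *
    have e : (1 - ((N : ℝ) + 1 + 1) ^ (1 - s)) / (s - 1) = (1 - ((N : ℝ) + 1) ^ (1 - s)) / (s - 1)
      + (((N : ℝ) + 1) ^ (1 - s) - ((N : ℝ) + 1 + 1) ^ (1 - s)) / (s - 1) := by ring
    linarith

lemma prod_primesLE_le {s : ℝ} (hs : 1 < s) (N : ℕ) :
    ∏ p ∈ N.primesLE, (1 - (p : ℝ) ^ (-s))⁻¹ ≤ 1 + 1 / (s - 1) := by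
  refine hasSum_le_of_sum_le (hasSum_smoothNumbers_rpow_neg (by linarith) N) fun A ↦ ?_
  have hmap : ∑ m ∈ A, ((m : ℕ) : ℝ) ^ (-s) =
      ∑ m ∈ A.map (Function.Embedding.subtype _), (m : ℝ) ^ (-s) := by simp
  rw [hmap]
  set B := A.map (Function.Embedding.subtype _)
  have hB : B ⊆ Finset.Icc 1 (B.sup id + 1) := fun m hm ↦ by
    have h1 : m ≠ 0 := by
      simp only [B, Finset.mem_map, Function.Embedding.subtype_apply] at hm
      obtain ⟨a, -, rfl⟩ := hm
      exact Nat.ne_zero_of_mem_smoothNumbers a.2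
    have h2 : m ≤ B.sup id := Finset.le_sup (f := id) hm
    simp only [Finset.mem_Icc]; omega
  refine (Finset.sum_le_sum_of_subset_of_nonneg hB fun _ _ _ ↦ by positivity).trans
    ((sum_Icc_rpow_neg_le hs _).trans ?_)
  have : (0 : ℝ) ≤ ((B.sup id : ℕ) + 1 : ℝ) ^ (1 - s) := by positivity
  gcongr
  linarith

lemma mul_rpow_sub_rpow_le {b : ℝ} (hb : 0 < b) (hb1 : b ≤ 1) {n : ℝ} (hn : 0 ≤ n) :
    n * (n ^ (b - 1) - (n + 1) ^ (b - 1)) ≤ ((n + 1) ^ b - n ^ b) / b := by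
  rcases hn.eq_or_lt with rfl | hn0
  · simp [zero_rpow hb.ne', hb.le]
  have hm : 0 < n + 1 := by linarith
  have h := rpow_one_add_le_one_add_mul_self (s := -(1 / (n + 1))) (p := b)
    (by rw [neg_le_neg_iff, div_le_one hm]; linarith) hb.le hb1
  have e : 1 + -(1 / (n + 1)) = n / (n + 1) := by field_simp; ring
  rw [e, div_rpow hn hm.le, div_le_iff₀ (by positivity)] at h
  have e2 : (n + 1) ^ (b - 1) = (n + 1) ^ b / (n + 1) := rpow_sub_one hm.ne' b
  have h1 : 0 ≤ (n + 1) ^ b / (n + 1) := by positivity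
  rw [le_div_iff₀ hb, rpow_sub_one hn0.ne', e2]
  have e3 : n * (n ^ b / n - (n + 1) ^ b / (n + 1)) =
      n ^ b - (n + 1) ^ b + (n + 1) ^ b / (n + 1) := by
    field_simp; ring
  have e4 : (1 + b * -(1 / (n + 1))) * (n + 1) ^ b =
      (n + 1) ^ b - b * ((n + 1) ^ b / (n + 1)) := by ring
  rw [e3]
  rw [e4] at h
  nlinarith [mul_le_mul_of_nonneg_right h (by linarith : 0 ≤ 1 + b),
    mul_nonneg h1 (sq_nonneg b)]

lemma sum_log_mul_rpow_le {b : ℝ} (hb : 0 < b) (hb1 : b ≤ 1) (N : ℕ) :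
    ∑ p ∈ N.primesLE, log p * (p : ℝ) ^ (b - 1) ≤ log 4 * (1 + 1 / b) * (N : ℝ) ^ b := by
  have key : ∑ p ∈ N.primesLE, log p * (p : ℝ) ^ (b - 1) ≤
      Chebyshev.theta N * (N : ℝ) ^ (b - 1) + log 4 * ((N : ℝ) ^ b / b) := by
    induction N with
    | zero => simp [Real.zero_rpow hb.ne']
    | succ n ih =>
      have h1 : ∀ f : ℕ → ℝ, ∑ p ∈ (n + 1).primesLE, f p =
          ∑ p ∈ n.primesLE, f p + if (n + 1).Prime then f (n + 1) else 0 := fun f ↦ by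
        simp only [Nat.primesLE_eq_filter_range, Finset.sum_filter]
        rw [Finset.sum_range_succ]
      have h2 : Chebyshev.theta n ≤ log 4 * n := Chebyshev.theta_le_log4_mul_x (by positivity)
      have h3 := mul_rpow_sub_rpow_le hb hb1 (n := n) (by positivity)
      have h4 : 0 ≤ (n : ℝ) ^ (b - 1) - ((n : ℝ) + 1) ^ (b - 1) ∨ n = 0 := by
        rcases Nat.eq_zero_or_pos n with h | h
        · exact Or.inr h
        · exact Or.inl (sub_nonneg.2 (Real.rpow_le_rpow_of_nonpos (by exact_mod_cast h)
            (by linarith) (by linarith)))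
      have h5 : Chebyshev.theta n * ((n : ℝ) ^ (b - 1) - ((n : ℝ) + 1) ^ (b - 1)) ≤
          log 4 * ((((n : ℝ) + 1) ^ b - (n : ℝ) ^ b) / b) := by
        have h0 : 0 ≤ log 4 := log_nonneg (by norm_num)
        rcases h4 with h4 | rfl
        · calc _ ≤ log 4 * n * ((n : ℝ) ^ (b - 1) - ((n : ℝ) + 1) ^ (b - 1)) := by gcongr
            _ = log 4 * (n * ((n : ℝ) ^ (b - 1) - ((n : ℝ) + 1) ^ (b - 1))) := by ring
            _ ≤ _ := by gcongr
        · simp [Real.zero_rpow hb.ne']; positivity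
      rw [h1]
      rw [Chebyshev.theta_eq_sum_primesLE_log] at *
      rw [h1 fun p ↦ log p]
      have e : log 4 * ((((n : ℝ) + 1) ^ b - (n : ℝ) ^ b) / b) =
        log 4 * (((n : ℝ) + 1) ^ b / b) - log 4 * ((n : ℝ) ^ b / b) := by ring
      push_cast at *
      split_ifs <;> linarith
  refine key.trans ?_
  have h2 : Chebyshev.theta N ≤ log 4 * N := Chebyshev.theta_le_log4_mul_x (by positivity)
  have h3 : (N : ℝ) * (N : ℝ) ^ (b - 1) = (N : ℝ) ^ b := by
    rcases Nat.eq_zero_or_pos N with rfl | h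
    · simp [Real.zero_rpow hb.ne']
    · rw [Real.rpow_sub_one (by positivity)]; field_simp
  have h4 : Chebyshev.theta N * (N : ℝ) ^ (b - 1) ≤ log 4 * N * (N : ℝ) ^ (b - 1) := by gcongr
  rw [mul_assoc, h3] at h4
  have e : log 4 * (1 + 1 / b) * (N : ℝ) ^ b = log 4 * (N : ℝ) ^ b + log 4 * ((N : ℝ) ^ b / b) := by
    ring
  linarith

lemma exp_sub_one_le_of_le {t w : ℝ} (ht : 0 ≤ t) (htw : t ≤ w) (hw : 0 < w) :
    exp t - 1 ≤ t / w * (exp w - 1) := by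
  have h := convexOn_exp.2 (Set.mem_univ 0) (Set.mem_univ w) (sub_nonneg.2 ((div_le_one hw).2 htw))
    (div_nonneg ht hw.le) (by ring)
  simp only [smul_eq_mul, mul_zero, zero_add, exp_zero, mul_one] at h
  rw [div_mul_cancel₀ _ hw.ne'] at h
  linarith

lemma exp_sub_one_le {t w : ℝ} (ht : 0 ≤ t) (htw : t ≤ w) (hw : 0 < w) :
    exp t - 1 ≤ 2 * exp (t / 2) * (t / w) * exp (w / 2) := by
  have h := exp_sub_one_le_of_le (t := t / 2) (w := w / 2) (by linarith) (by linarith)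
    (by linarith)
  have e : exp t = exp (t / 2) * exp (t / 2) := by rw [← exp_add]; ring_nf
  have h1 : 1 ≤ exp (t / 2) := one_le_exp (by linarith)
  have e2 : t / 2 / (w / 2) = t / w := by field_simp
  rw [e2] at h
  have h3 : 0 ≤ t / w := by positivity
  calc exp t - 1 = (exp (t / 2) + 1) * (exp (t / 2) - 1) := by rw [e]; ring
    _ ≤ (2 * exp (t / 2)) * (t / w * (exp (w / 2) - 1)) := by
      gcongr
      linarith
    _ ≤ (2 * exp (t / 2)) * (t / w * exp (w / 2)) := by gcongr; linarith
    _ = _ := by ring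

/-- A bound of order `z ^ a / log (z ^ a)` for the excess of `∑ p ^ (a - 1)` over `∑ 1 / p`. -/
lemma sum_rpow_sub_one_div_le {a z : ℝ} (ha : 0 < a) (ha2 : a ≤ 2) (hz : 1 < z) :
    ∑ p ∈ ⌊z⌋₊.primesLE, ((p : ℝ) ^ a - 1) / p ≤ 8 * log 4 * (z ^ a / (a * log z)) := by
  have hL : 0 < log z := log_pos hz
  have hN : (⌊z⌋₊ : ℝ) ≤ z := Nat.floor_le (by linarith)
  calc _ ≤ ∑ p ∈ ⌊z⌋₊.primesLE, 2 * z ^ (a / 2) / log z * (log p * (p : ℝ) ^ (a / 2 - 1)) := by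
        refine Finset.sum_le_sum fun p hp ↦ ?_
        have hp1 : (1 : ℝ) < p := by exact_mod_cast Nat.one_lt_of_mem_primesLE hp
        have hp0 : (0 : ℝ) < p := by linarith
        have hpz : (p : ℝ) ≤ z := le_trans (by exact_mod_cast Nat.le_of_mem_primesLE hp) hN
        have hl : 0 < log p := log_pos hp1
        have hlz : log p ≤ log z := log_le_log hp0 hpz
        have h := exp_sub_one_le (t := log p * a) (w := log z * a) (by positivity) (by gcongr)
          (by positivity)
        rw [mul_div_mul_right _ _ ha.ne', mul_div_assoc, mul_div_assoc, ← rpow_def_of_pos hp0,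
          ← rpow_def_of_pos hp0, ← rpow_def_of_pos (by linarith : 0 < z)] at h
        rw [rpow_sub_one hp0.ne', div_le_iff₀ hp0]
        refine h.trans (le_of_eq ?_)
        field_simp
    _ = 2 * z ^ (a / 2) / log z * ∑ p ∈ ⌊z⌋₊.primesLE, log p * (p : ℝ) ^ (a / 2 - 1) := by
        rw [Finset.mul_sum]
    _ ≤ 2 * z ^ (a / 2) / log z * (log 4 * (1 + 1 / (a / 2)) * (⌊z⌋₊ : ℝ) ^ (a / 2)) := by
        gcongr
        exact sum_log_mul_rpow_le (by linarith) (by linarith) _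
    _ ≤ 2 * z ^ (a / 2) / log z * (log 4 * (4 / a) * z ^ (a / 2)) := by
        have h0 : 0 ≤ log 4 := log_nonneg (by norm_num)
        gcongr
        rw [div_div_eq_mul_div, le_div_iff₀ ha, add_mul, div_mul_cancel₀ _ ha.ne']
        linarith
    _ = 8 * log 4 * (z ^ (a / 2) * z ^ (a / 2) / (a * log z)) := by field_simp; ring
    _ = _ := by rw [← rpow_add (by linarith)]; ring_nf

lemma inv_one_sub_le_mul_exp {s t : ℝ} (hs : 1 / 4 ≤ s) (hst : s ≤ t) {p : ℝ} (hp : 2 ≤ p) :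
    (1 - p ^ (-s))⁻¹ ≤ (1 - p ^ (-t))⁻¹ * exp (7 * (p ^ (-s) - p ^ (-t))) := by
  have h1 : p ^ (-t) ≤ p ^ (-s) := rpow_le_rpow_of_exponent_le (by linarith) (by linarith)
  have h2 : p ^ (-s) ≤ 6 / 7 := by
    calc p ^ (-s) ≤ p ^ (-(1 / 4 : ℝ)) := rpow_le_rpow_of_exponent_le (by linarith) (by linarith)
      _ ≤ 2 ^ (-(1 / 4 : ℝ)) := rpow_le_rpow_of_nonpos (by norm_num) hp (by norm_num)
      _ ≤ 6 / 7 := by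
        have h : ((2 : ℝ) ^ (-(1 / 4 : ℝ))) ^ 4 ≤ (6 / 7 : ℝ) ^ 4 := by
          rw [← rpow_natCast, ← rpow_mul (by norm_num)]
          norm_num
        exact le_of_pow_le_pow_left₀ (by norm_num) (by norm_num) h
  have h3 := add_one_le_exp (7 * (p ^ (-s) - p ^ (-t)))
  rw [inv_mul_eq_div, ← one_div, div_le_div_iff₀ (by linarith) (by linarith)]
  nlinarith [mul_le_mul_of_nonneg_left h3 (by linarith : 0 ≤ 1 - p ^ (-s))]

lemma prod_primesLE_le_log_mul_exp {σ z : ℝ} (hσ : 1 / 4 ≤ σ) (hσ1 : σ ≤ 1) (hz1 : 1 < z)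
    (hz : 4 ≤ log z) :
    ∏ p ∈ ⌊z⌋₊.primesLE, (1 - (p : ℝ) ^ (-σ))⁻¹ ≤ (1 + log z) *
      exp (56 * log 4 * (exp ((1 - σ) * log z + 1) / ((1 - σ) * log z + 1))) := by
  have hz0 : 0 < z := by linarith
  set t := 1 + 1 / log z with ht
  have hinv : 1 / log z ≤ 1 / 4 := by gcongr
  have hinv0 : 0 < 1 / log z := by positivity
  have hf : ∀ {r : ℝ}, 0 < r → ∀ p ∈ ⌊z⌋₊.primesLE, 0 ≤ (1 - (p : ℝ) ^ (-r))⁻¹ := by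
    intro r hr p hp
    have hp1 : (1 : ℝ) < p := by exact_mod_cast Nat.one_lt_of_mem_primesLE hp
    rw [inv_nonneg, sub_nonneg]
    exact (rpow_lt_one_of_one_lt_of_neg hp1 (by linarith)).le
  calc _ ≤ ∏ p ∈ ⌊z⌋₊.primesLE, ((1 - (p : ℝ) ^ (-t))⁻¹ *
          exp (7 * ((p : ℝ) ^ (-σ) - (p : ℝ) ^ (-t)))) := by
        refine Finset.prod_le_prod (hf (by linarith)) fun p hp ↦ ?_
        exact inv_one_sub_le_mul_exp hσ (by linarith)
          (by exact_mod_cast Nat.two_le_of_mem_primesLE hp)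
    _ = (∏ p ∈ ⌊z⌋₊.primesLE, (1 - (p : ℝ) ^ (-t))⁻¹) *
          exp (7 * ∑ p ∈ ⌊z⌋₊.primesLE, ((p : ℝ) ^ (-σ) - (p : ℝ) ^ (-t))) := by
        rw [Finset.prod_mul_distrib, ← exp_sum, Finset.mul_sum]
    _ ≤ (1 + 1 / (t - 1)) * exp (7 * (8 * log 4 * (z ^ (t - σ) / ((t - σ) * log z)))) := by
        gcongr
        · have : 0 < t - 1 := by linarith
          positivity
        · exact prod_primesLE_le (by linarith) _
        refine le_trans (Finset.sum_le_sum fun p hp ↦ ?_)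
          (sum_rpow_sub_one_div_le (by linarith) (by linarith) hz1)
        have hp1 : (1 : ℝ) < p := by exact_mod_cast Nat.one_lt_of_mem_primesLE hp
        have hp0 : (0 : ℝ) < p := by linarith
        have e1 : (p : ℝ) ^ (-σ) = (p : ℝ) ^ (-t) * (p : ℝ) ^ (t - σ) := by
          rw [← rpow_add hp0]; ring_nf
        have e2 : (p : ℝ) ^ (-t) ≤ 1 / p := by
          rw [one_div, ← rpow_neg_one]
          exact rpow_le_rpow_of_exponent_le hp1.le (by linarith)
        have e3 : 1 ≤ (p : ℝ) ^ (t - σ) := one_le_rpow hp1.le (by linarith)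
        calc _ = (p : ℝ) ^ (-t) * ((p : ℝ) ^ (t - σ) - 1) := by rw [e1]; ring
          _ ≤ 1 / p * ((p : ℝ) ^ (t - σ) - 1) := by gcongr
          _ = _ := by ring
    _ = _ := by
        have e1 : (t - σ) * log z = (1 - σ) * log z + 1 := by
          rw [ht]; field_simp; ring
        have e2 : z ^ (t - σ) = exp ((1 - σ) * log z + 1) := by
          rw [rpow_def_of_pos hz0, ← e1, mul_comm]
        rw [e1, e2, ht]
        congr 1
        · field_simp; ring
        · ring_nf
lemma Psi_eq_card {x z : ℝ} (hx : 0 ≤ x) (hz : 0 ≤ z) :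
    Psi x z = (Nat.smoothNumbersUpTo ⌊x⌋₊ (⌊z⌋₊ + 1)).card := by
  rw [Psi, ← Nat.card_eq_finsetCard]
  refine Nat.card_congr (Equiv.subtypeEquivRight fun n ↦ ?_)
  rw [Nat.mem_smoothNumbersUpTo, Nat.mem_smoothNumbers]
  simp only [Nat.mem_primeFactorsList', Nat.le_floor_iff hx, Nat.lt_succ_iff, Nat.le_floor_iff hz]
  exact ⟨fun h ↦ ⟨h.2.1, h.1.ne', fun p hp ↦ h.2.2 p hp.1 hp.2.1⟩,
    fun h ↦ ⟨Nat.pos_of_ne_zero h.2.1, h.1, fun p hp hpn ↦ h.2.2 p ⟨hp, hpn, h.2.1⟩⟩⟩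

lemma Psi_mono_right {x z w : ℝ} (hx : 0 ≤ x) (hz : 0 ≤ z) (hzw : z ≤ w) :
    Psi x z ≤ Psi x w := by
  rw [Psi_eq_card hx hz, Psi_eq_card hx (hz.trans hzw)]
  refine Finset.card_le_card fun n hn ↦ ?_
  rw [Nat.mem_smoothNumbersUpTo] at hn ⊢
  exact ⟨hn.1, Nat.smoothNumbers_mono (by gcongr) hn.2⟩

lemma Psi_le_self {x z : ℝ} (hx : 0 ≤ x) (hz : 0 ≤ z) : (Psi x z : ℝ) ≤ x := by
  rw [Psi_eq_card hx hz]
  have h : Nat.smoothNumbersUpTo ⌊x⌋₊ (⌊z⌋₊ + 1) ⊆ Finset.Ioc 0 ⌊x⌋₊ := fun n hn ↦ by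
    rw [Nat.mem_smoothNumbersUpTo] at hn
    rw [Finset.mem_Ioc]
    exact ⟨Nat.pos_of_ne_zero (Nat.ne_zero_of_mem_smoothNumbers hn.2), hn.1⟩
  have h1 := Finset.card_le_card h
  rw [Nat.card_Ioc, Nat.sub_zero] at h1
  exact (Nat.cast_le.2 h1).trans (Nat.floor_le hx)

/-- Discarding the `n ≤ √x` and weighting the others by `log n`. -/
lemma Psi_le_sqrt_add_sum_log {x z : ℝ} (hx : 1 < x) (hz : 0 ≤ z) :
    (Psi x z : ℝ) ≤ √x + 2 / log x * ∑ n ∈ Nat.smoothNumbersUpTo ⌊x⌋₊ (⌊z⌋₊ + 1), log n := by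
  classical
  set S := Nat.smoothNumbersUpTo ⌊x⌋₊ (⌊z⌋₊ + 1)
  have hL : 0 < log x := log_pos hx
  have hpos : ∀ n ∈ S, 1 ≤ n := fun n hn ↦
    Nat.pos_of_ne_zero (Nat.ne_zero_of_mem_smoothNumbers (Nat.mem_smoothNumbersUpTo.1 hn).2)
  rw [Psi_eq_card (by linarith) hz,
    ← Finset.card_filter_add_card_filter_not (fun n : ℕ ↦ (n : ℝ) ≤ √x)]
  push_cast
  gcongr ?_ + ?_
  · have h : S.filter (fun n : ℕ ↦ (n : ℝ) ≤ √x) ⊆ Finset.Ioc 0 ⌊√x⌋₊ := fun n hn ↦ by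
      rw [Finset.mem_filter] at hn
      rw [Finset.mem_Ioc]
      exact ⟨hpos n hn.1, Nat.le_floor hn.2⟩
    have h1 := Finset.card_le_card h
    rw [Nat.card_Ioc, Nat.sub_zero] at h1
    exact (Nat.cast_le.2 h1).trans (Nat.floor_le (sqrt_nonneg x))
  · rw [Finset.card_eq_sum_ones, Finset.mul_sum]
    push_cast
    refine (Finset.sum_le_sum fun n hn ↦ ?_).trans
      (Finset.sum_le_sum_of_subset_of_nonneg (Finset.filter_subset _ S) fun n hn _ ↦ ?_)
    · rw [Finset.mem_filter, not_le] at hn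
      have h1 : log √x ≤ log n := log_le_log (sqrt_pos.2 (by linarith)) hn.2.le
      rw [log_sqrt (by linarith)] at h1
      rw [div_mul_eq_mul_div, le_div_iff₀ hL]
      linarith
    · have := log_nonneg (show (1 : ℝ) ≤ n by exact_mod_cast hpos n hn)
      positivity

lemma sum_log_smoothNumbersUpTo_le (M k : ℕ) :
    ∑ n ∈ Nat.smoothNumbersUpTo M k, log n ≤ ∑ m ∈ Nat.smoothNumbersUpTo M k,
      ∑ d ∈ Nat.smoothNumbersUpTo (M / m) k, ArithmeticFunction.vonMangoldt d := by
  have h0 : ∀ n ∈ Nat.smoothNumbersUpTo M k, n ≠ 0 := fun n hn ↦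
    Nat.ne_zero_of_mem_smoothNumbers (Nat.mem_smoothNumbersUpTo.1 hn).2
  calc ∑ n ∈ Nat.smoothNumbersUpTo M k, log n
      = ∑ n ∈ Nat.smoothNumbersUpTo M k, ∑ d ∈ n.divisors, ArithmeticFunction.vonMangoldt d := by
        simp_rw [ArithmeticFunction.vonMangoldt_sum]
    _ = ∑ q ∈ (Nat.smoothNumbersUpTo M k).sigma (fun n ↦ n.divisors),
          ArithmeticFunction.vonMangoldt q.2 := by rw [Finset.sum_sigma]
    _ = ∑ q ∈ ((Nat.smoothNumbersUpTo M k).sigma (fun n ↦ n.divisors)).image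
          (fun q : (_ : ℕ) × ℕ ↦ (⟨q.1 / q.2, q.2⟩ : (_ : ℕ) × ℕ)),
          ArithmeticFunction.vonMangoldt q.2 := by
        rw [Finset.sum_image]
        rintro ⟨a, b⟩ hab ⟨c, d⟩ hcd h
        simp only [Finset.coe_sigma, Set.mem_sigma_iff, Finset.mem_coe, Nat.mem_divisors] at hab hcd
        simp only [Sigma.mk.injEq, heq_eq_eq] at h ⊢
        obtain ⟨h1, rfl⟩ := h
        exact ⟨(Nat.div_left_inj hab.2.1 hcd.2.1).1 h1, rfl⟩
    _ ≤ ∑ q ∈ (Nat.smoothNumbersUpTo M k).sigma (fun m ↦ Nat.smoothNumbersUpTo (M / m) k),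
          ArithmeticFunction.vonMangoldt q.2 := by
        refine Finset.sum_le_sum_of_subset_of_nonneg (fun q hq ↦ ?_)
          fun _ _ _ ↦ ArithmeticFunction.vonMangoldt_nonneg
        rw [Finset.mem_image] at hq
        obtain ⟨⟨a, b⟩, hab, rfl⟩ := hq
        simp only [Finset.mem_sigma, Nat.mem_divisors, Nat.mem_smoothNumbersUpTo] at hab ⊢
        obtain ⟨⟨haM, ha⟩, hba, ha0⟩ := hab
        obtain ⟨c, rfl⟩ := hba
        have hb : 0 < b := Nat.pos_of_ne_zero (left_ne_zero_of_mul ha0)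
        have hc : 0 < c := Nat.pos_of_ne_zero (right_ne_zero_of_mul ha0)
        rw [Nat.mul_div_cancel_left c hb]
        refine ⟨⟨le_trans (Nat.le_mul_of_pos_left c hb) haM,
          Nat.mem_smoothNumbers_of_dvd ha (Dvd.intro_left b rfl)⟩,
          (Nat.le_div_iff_mul_le hc).2 haM, Nat.mem_smoothNumbers_of_dvd ha (Dvd.intro c rfl)⟩
    _ = _ := by rw [Finset.sum_sigma]

lemma sum_vonMangoldt_smoothNumbersUpTo_le_psi (M k : ℕ) :
    ∑ d ∈ Nat.smoothNumbersUpTo M k, ArithmeticFunction.vonMangoldt d ≤ Chebyshev.psi M := by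
  rw [Chebyshev.psi, Nat.floor_natCast]
  refine Finset.sum_le_sum_of_subset_of_nonneg (fun n hn ↦ ?_)
    fun _ _ _ ↦ ArithmeticFunction.vonMangoldt_nonneg
  rw [Nat.mem_smoothNumbersUpTo] at hn
  rw [Finset.mem_Ioc]
  exact ⟨Nat.pos_of_ne_zero (Nat.ne_zero_of_mem_smoothNumbers hn.2), hn.1⟩

lemma sum_vonMangoldt_smoothNumbersUpTo_le_card (M N : ℕ) :
    ∑ d ∈ Nat.smoothNumbersUpTo M (N + 1), ArithmeticFunction.vonMangoldt d ≤
      Nat.primeCounting N * log M := by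
  classical
  rcases Nat.eq_zero_or_pos M with rfl | hM
  · refine (sum_vonMangoldt_smoothNumbersUpTo_le_psi 0 (N + 1)).trans ?_
    simp
  set B := (Nat.smoothNumbersUpTo M (N + 1)).filter IsPrimePow
  have hB : ∑ d ∈ Nat.smoothNumbersUpTo M (N + 1), ArithmeticFunction.vonMangoldt d =
      ∑ d ∈ B, ArithmeticFunction.vonMangoldt d := by
    rw [Finset.sum_filter]
    refine Finset.sum_congr rfl fun d _ ↦ ?_
    split_ifs with h
    · rfl
    · exact ArithmeticFunction.vonMangoldt_eq_zero_iff.2 h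
  have hmaps : ∀ d ∈ B, d.minFac ∈ N.primesLE := fun d hd ↦ by
    simp only [B, Finset.mem_filter, Nat.mem_smoothNumbersUpTo, Nat.mem_smoothNumbers'] at hd
    have hp := Nat.minFac_prime hd.2.ne_one
    exact Nat.mem_primesLE.2 ⟨Nat.lt_succ_iff.1 (hd.1.2 _ hp d.minFac_dvd), hp⟩
  rw [hB, ← Finset.sum_fiberwise_of_maps_to hmaps]
  have hcard : (Nat.primeCounting N : ℝ) = (N.primesLE.card : ℝ) := by
    rw [Nat.primesLE_card_eq_primeCounting]
  rw [hcard, ← nsmul_eq_mul]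
  refine Finset.sum_le_card_nsmul _ _ _ fun p hp ↦ ?_
  have hpp := Nat.prime_of_mem_primesLE hp
  have hsub : B.filter (fun d ↦ d.minFac = p) ⊆ (Finset.Icc 1 (Nat.log p M)).image (p ^ ·) := by
    intro d hd
    simp only [B, Finset.mem_filter, Nat.mem_smoothNumbersUpTo] at hd
    obtain ⟨⟨⟨hdM, -⟩, hpow⟩, hmin⟩ := hd
    obtain ⟨q, k, hq, hk, rfl⟩ := (isPrimePow_nat_iff d).1 hpow
    rw [hq.pow_minFac hk.ne'] at hmin
    subst hmin
    rw [Finset.mem_image]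
    exact ⟨k, Finset.mem_Icc.2 ⟨hk, Nat.le_log_of_pow_le hq.one_lt hdM⟩, rfl⟩
  calc ∑ d ∈ B with d.minFac = p, ArithmeticFunction.vonMangoldt d
      ≤ ∑ d ∈ (Finset.Icc 1 (Nat.log p M)).image (p ^ ·), ArithmeticFunction.vonMangoldt d :=
        Finset.sum_le_sum_of_subset_of_nonneg hsub
          fun _ _ _ ↦ ArithmeticFunction.vonMangoldt_nonneg
    _ = ∑ k ∈ Finset.Icc 1 (Nat.log p M), log p := by
        rw [Finset.sum_image fun a _ b _ h ↦ Nat.pow_right_injective hpp.two_le h]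
        refine Finset.sum_congr rfl fun k hk ↦ ?_
        rw [ArithmeticFunction.vonMangoldt_apply_pow (by
          have := (Finset.mem_Icc.1 hk).1; omega),
          ArithmeticFunction.vonMangoldt_apply_prime hpp]
    _ = log ((p ^ Nat.log p M : ℕ) : ℝ) := by simp
    _ ≤ log M := by
        refine log_le_log (by exact_mod_cast pow_pos hpp.pos _) ?_
        exact_mod_cast Nat.pow_log_le_self p hM.ne'

lemma log_four_le_two : log 4 ≤ 2 := by
  rw [show (4 : ℝ) = 2 ^ (2 : ℕ) by norm_num, log_pow]
  push_cast
  linarith [log_two_lt_d9]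

lemma primeCounting_floor_mul_log_le {z : ℝ} (hz : 1 < z) :
    (Nat.primeCounting ⌊z⌋₊ : ℝ) * log z ≤ 6 * z := by
  have hL : 0 < log z := log_pos hz
  have h := Chebyshev.pi_le_log4_mul_div hz
  rw [log_sqrt (by linarith)] at h
  have h4 := log_four_le_two
  have h2 : log z ≤ 2 * √z := by
    have := log_le_sub_one_of_pos (sqrt_pos.2 (by linarith : 0 < z))
    rw [log_sqrt (by linarith)] at this
    linarith
  have h3 : √z * log z ≤ 2 * z := by
    nlinarith [sqrt_nonneg z, mul_self_sqrt (by linarith : 0 ≤ z)]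
  calc _ ≤ (log 4 * z / (log z / 2) + √z) * log z := by gcongr
    _ = 2 * log 4 * z + √z * log z := by field_simp
    _ ≤ _ := by nlinarith

lemma sum_vonMangoldt_smoothNumbersUpTo_le {σ y z : ℝ} {M : ℕ} (hz : 1 < z) (hy : 1 ≤ y)
    (hM : (M : ℝ) ≤ y) (hσ1 : σ ≤ 1) (hσ : 1 ≤ σ * log z) :
    ∑ d ∈ Nat.smoothNumbersUpTo M (⌊z⌋₊ + 1), ArithmeticFunction.vonMangoldt d ≤
      6 * (y ^ σ * z ^ (1 - σ)) := by
  have hL : 0 < log z := log_pos hz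
  have hz0 : 0 < z := by linarith
  have hy0 : 0 < y := by linarith
  rcases le_total y z with h | h
  · calc _ ≤ Chebyshev.psi M := sum_vonMangoldt_smoothNumbersUpTo_le_psi _ _
      _ ≤ (log 4 + 4) * M := Chebyshev.psi_le_const_mul_self (by positivity)
      _ ≤ 6 * y := by
        gcongr
        linarith [log_four_le_two]
      _ = 6 * (y ^ σ * y ^ (1 - σ)) := by rw [← rpow_add hy0]; simp
      _ ≤ _ := by gcongr
  · have hyz : 0 ≤ log y - log z := sub_nonneg.2 (log_le_log hz0 h)
    have hlogM : log M ≤ log y := by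
      rcases Nat.eq_zero_or_pos M with rfl | h0
      · simpa using log_nonneg hy
      · exact log_le_log (by exact_mod_cast h0) hM
    calc _ ≤ Nat.primeCounting ⌊z⌋₊ * log M := sum_vonMangoldt_smoothNumbersUpTo_le_card _ _
      _ ≤ Nat.primeCounting ⌊z⌋₊ * log y := by gcongr
      _ = Nat.primeCounting ⌊z⌋₊ * log z * (log y / log z) := by field_simp
      _ ≤ 6 * z * (log y / log z) := by
        have : 0 ≤ log y := log_nonneg hy
        gcongr ?_ * (log y / log z)
        exact primeCounting_floor_mul_log_le hz
      _ ≤ 6 * z * exp (σ * (log y - log z)) := by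
        gcongr
        refine le_trans ?_ (add_one_le_exp _)
        rw [div_le_iff₀ hL]
        nlinarith [mul_le_mul_of_nonneg_right hσ hyz]
      _ = _ := by
        rw [mul_assoc]
        congr 1
        nth_rewrite 1 [← exp_log hz0]
        rw [rpow_def_of_pos hy0, rpow_def_of_pos hz0, ← exp_add, ← exp_add]
        ring_nf

lemma Psi_le_sqrt_add_mul_prod {σ x z : ℝ} (hx : 1 < x) (hz : 1 < z) (hσ0 : 0 < σ) (hσ1 : σ ≤ 1)
    (hσ : 1 ≤ σ * log z) :
    (Psi x z : ℝ) ≤ √x + 12 / log x * (x ^ σ * z ^ (1 - σ)) *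
      ∏ p ∈ ⌊z⌋₊.primesLE, (1 - (p : ℝ) ^ (-σ))⁻¹ := by
  have hL : 0 < log x := log_pos hx
  refine (Psi_le_sqrt_add_sum_log hx (by linarith)).trans ?_
  have h : ∑ n ∈ Nat.smoothNumbersUpTo ⌊x⌋₊ (⌊z⌋₊ + 1), log n ≤
      6 * (x ^ σ * z ^ (1 - σ)) * ∏ p ∈ ⌊z⌋₊.primesLE, (1 - (p : ℝ) ^ (-σ))⁻¹ := by
    calc _ ≤ _ := sum_log_smoothNumbersUpTo_le _ _
      _ ≤ ∑ m ∈ Nat.smoothNumbersUpTo ⌊x⌋₊ (⌊z⌋₊ + 1),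
            6 * (x ^ σ * z ^ (1 - σ)) * (m : ℝ) ^ (-σ) := by
          refine Finset.sum_le_sum fun m hm ↦ ?_
          rw [Nat.mem_smoothNumbersUpTo] at hm
          have hm0 : (0 : ℝ) < m := by
            exact_mod_cast Nat.pos_of_ne_zero (Nat.ne_zero_of_mem_smoothNumbers hm.2)
          have hfl : (⌊x⌋₊ : ℝ) ≤ x := Nat.floor_le (by linarith)
          have hmx : (m : ℝ) ≤ x := le_trans (by exact_mod_cast hm.1) hfl
          refine (sum_vonMangoldt_smoothNumbersUpTo_le (y := x / m) hz ((one_le_div hm0).2 hmx)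
            (Nat.cast_div_le.trans (by gcongr)) hσ1 hσ).trans (le_of_eq ?_)
          rw [div_rpow (by linarith) hm0.le, rpow_neg hm0.le]
          ring
      _ = 6 * (x ^ σ * z ^ (1 - σ)) *
            ∑ m ∈ Nat.smoothNumbersUpTo ⌊x⌋₊ (⌊z⌋₊ + 1), (m : ℝ) ^ (-σ) := by
          rw [Finset.mul_sum]
      _ ≤ _ := by
          gcongr
          exact sum_rpow_neg_le_prod hσ0 fun m hm ↦ (Nat.mem_smoothNumbersUpTo.1 hm).2
  have h2 := mul_le_mul_of_nonneg_left h (by positivity : 0 ≤ 2 / log x)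
  have e : 2 / log x * (6 * (x ^ σ * z ^ (1 - σ)) *
      ∏ p ∈ ⌊z⌋₊.primesLE, (1 - (p : ℝ) ^ (-σ))⁻¹) = 12 / log x * (x ^ σ * z ^ (1 - σ)) *
      ∏ p ∈ ⌊z⌋₊.primesLE, (1 - (p : ℝ) ^ (-σ))⁻¹ := by ring
  linarith

lemma mul_div_two_add_log_le {c u : ℝ} (hc : 0 ≤ c) (hu : 1 ≤ u) :
    c * (u / (2 + log u)) ≤ u + c * exp c := by
  have hl : 0 ≤ log u := log_nonneg hu
  have h0 : 0 ≤ c * exp c := by positivity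
  rcases le_total c (2 + log u) with h | h
  · have : c * (u / (2 + log u)) ≤ u := by
      rw [← mul_div_assoc, div_le_iff₀ (by linarith)]
      nlinarith
    linarith
  · have h1 : u ≤ exp c := by
      rw [← log_le_iff_le_exp (by linarith)]
      linarith
    calc c * (u / (2 + log u)) ≤ c * (exp c / 1) := by gcongr; linarith
      _ ≤ _ := by rw [div_one]; linarith

/-- Rankin's bound with exponent `1 - (1 + log u) / log z`. -/
lemma Psi_le_of_le_sqrt {x z u : ℝ} (hz : 1 < z) (hu : u = log x / log z) (hx : 1 < x)
    (hu8 : 8 ≤ u) (huz : u ≤ √z) :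
    (Psi x z : ℝ) ≤ √x + 45 * exp (56 * log 4 * exp 2 * exp (56 * log 4 * exp 2)) *
      (x * u ^ (-u)) := by
  have hu0 : 0 < u := by linarith
  have hL : 4 ≤ log z := by
    have h1 : log 8 ≤ log √z := log_le_log (by norm_num) (hu8.trans huz)
    rw [log_sqrt (by linarith), show (8 : ℝ) = 2 ^ (3 : ℕ) by norm_num, log_pow] at h1
    push_cast at h1
    linarith [log_two_gt_d9]
  have hlu : 0 ≤ log u := log_nonneg (by linarith)
  have hlu2 : log u ≤ log z / 2 := by
    rw [← log_sqrt (by linarith)]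
    exact log_le_log hu0 huz
  have hxu : log x = u * log z := by rw [hu]; field_simp
  set σ := 1 - (1 + log u) / log z with hσ
  have hσL : (1 - σ) * log z = 1 + log u := by rw [hσ]; field_simp; ring
  have hq : (1 + log u) / log z ≤ 3 / 4 := by
    rw [div_le_iff₀ (by linarith)]; linarith
  have hq0 : 0 ≤ (1 + log u) / log z := by positivity
  have hmain := Psi_le_sqrt_add_mul_prod (σ := σ) hx hz (by linarith) (by linarith) (by nlinarith)
  have hprod := prod_primesLE_le_log_mul_exp (σ := σ) (by linarith) (by linarith) hz hL
  set c := 56 * log 4 * exp 2 with hc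
  have hc0 : 0 ≤ c := by
    have : 0 ≤ log 4 := log_nonneg (by norm_num)
    positivity
  have e1 : 56 * log 4 * (exp ((1 - σ) * log z + 1) / ((1 - σ) * log z + 1)) =
      c * (u / (2 + log u)) := by
    rw [hσL, show 1 + log u + 1 = 2 + log u by ring, exp_add, exp_log hu0]
    ring
  have e2 : z ^ (1 - σ) = exp 1 * u := by
    rw [rpow_def_of_pos (by linarith), mul_comm, hσL, exp_add, exp_log hu0]
  have e3 : x ^ σ = x * u ^ (-u) * exp (-u) := by
    have h : log x * σ = log x + log u * (-u) + (-u) := by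
      have : log x * σ = u * log z - u * ((1 - σ) * log z) := by rw [hxu]; ring
      rw [this, hσL, hxu]; ring
    rw [rpow_def_of_pos (by linarith), h, exp_add, exp_add, exp_log (by linarith),
      ← rpow_def_of_pos hu0]
  rw [e1] at hprod
  have hxpow : 0 ≤ x * u ^ (-u) := by positivity
  have hlx : 0 < log x := log_pos hx
  refine hmain.trans (add_le_add le_rfl ?_)
  calc _ ≤ 12 / log x * (x ^ σ * z ^ (1 - σ)) *
        ((1 + log z) * exp (c * (u / (2 + log u)))) := by gcongr
    _ ≤ 12 / log x * (x ^ σ * z ^ (1 - σ)) *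
        ((1 + log z) * exp (u + c * exp c)) := by
      gcongr
      exact mul_div_two_add_log_le hc0 (by linarith)
    _ = 12 * exp 1 * ((1 + log z) / log z) * exp (c * exp c) * (x * u ^ (-u)) *
        (exp (-u) * exp u) := by
      rw [e2, e3, exp_add, hxu]; field_simp
    _ = 12 * exp 1 * ((1 + log z) / log z) * exp (c * exp c) * (x * u ^ (-u)) := by
      rw [← exp_add]; simp
    _ ≤ 12 * 3 * (5 / 4) * exp (c * exp c) * (x * u ^ (-u)) := by
      have h1 : exp 1 ≤ 3 := by linarith [exp_one_lt_d9]
      have h2 : (1 + log z) / log z ≤ 5 / 4 := by rw [div_le_iff₀ (by linarith)]; linarith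
      gcongr
    _ = _ := by ring

lemma exists_Psi_le_of_le_sqrt : ∃ C : ℝ, 0 < C ∧ ∀ x z : ℝ, 1 < z → z ≤ x →
    log x / log z ≤ √z →
    (Psi x z : ℝ) ≤ C * (x * (log x / log z) ^ (-(log x / log z)) + √x) := by
  refine ⟨8 ^ (8 : ℝ) + 45 * exp (56 * log 4 * exp 2 * exp (56 * log 4 * exp 2)),
    by positivity, fun x z hz hzx huz ↦ ?_⟩
  set K := 45 * exp (56 * log 4 * exp 2 * exp (56 * log 4 * exp 2))
  have hx : 1 < x := by linarith
  have hL : 0 < log z := log_pos hz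
  set u := log x / log z with hu
  have hu1 : 1 ≤ u := (one_le_div hL).2 (log_le_log (by linarith) hzx)
  have hu0 : 0 < u := by linarith
  have hP : 0 ≤ x * u ^ (-u) := by positivity
  have hS : 0 ≤ √x := sqrt_nonneg x
  have h8 : (1 : ℝ) ≤ 8 ^ (8 : ℝ) := one_le_rpow (by norm_num) (by norm_num)
  have hK : 0 ≤ K := by positivity
  rcases le_total u 8 with h | h
  · have h1 : u ^ u ≤ 8 ^ (8 : ℝ) :=
      (rpow_le_rpow hu0.le h hu0.le).trans (rpow_le_rpow_of_exponent_le (by norm_num) h)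
    have h2 : x ≤ 8 ^ (8 : ℝ) * (x * u ^ (-u)) := by
      calc x = u ^ u * (x * u ^ (-u)) := by
            rw [rpow_neg hu0.le]; field_simp
        _ ≤ _ := by gcongr
    have h3 := Psi_le_self (x := x) (z := z) (by linarith) (by linarith)
    nlinarith [mul_nonneg hK hP, mul_nonneg hK hS,
      mul_nonneg (by linarith : (0 : ℝ) ≤ 8 ^ (8 : ℝ)) hS]
  · have h3 := Psi_le_of_le_sqrt hz hu hx h huz
    nlinarith [mul_nonneg hK hS, mul_nonneg (by linarith : (0 : ℝ) ≤ 8 ^ (8 : ℝ)) hP]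

lemma exists_sqrt_mul_log_eq {x z : ℝ} (hz : 1 ≤ z) (hzx : z ≤ x) (h : √z * log z ≤ log x) :
    ∃ w, z ≤ w ∧ w ≤ x ∧ √w * log w = log x := by
  have hcont : ContinuousOn (fun t ↦ √t * log t) (Set.Icc z x) :=
    continuous_sqrt.continuousOn.mul
      (continuousOn_log.mono fun t ht ↦ (by linarith [ht.1] : (0 : ℝ) < t).ne')
  have hx : log x ≤ √x * log x :=
    le_mul_of_one_le_left (log_nonneg (hz.trans hzx)) (one_le_sqrt.2 (hz.trans hzx))
  obtain ⟨w, hw, hwx⟩ := intermediate_value_Icc hzx hcont ⟨h, hx⟩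
  exact ⟨w, hw.1, hw.2, hwx⟩

/-- There is `C > 0` such that for all `x ≥ z ≥ 3`,
`Ψ(x, z) ≤ C · (x · u ^ (−u) + √x)` where `u = log x / log z`. -/
theorem Psi_le : ∃ C : ℝ, 0 < C ∧ ∀ x z : ℝ, 3 ≤ z → z ≤ x →
    (Psi x z : ℝ) ≤ C * (x * (Real.log x / Real.log z) ^ (-(Real.log x / Real.log z)) +
      Real.sqrt x) := by
  obtain ⟨C, hC, hP⟩ := exists_Psi_le_of_le_sqrt
  refine ⟨2 * C, by positivity, fun x z hz hzx ↦ ?_⟩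
  have hx0 : 0 < x := by linarith
  have hL : 0 < log z := log_pos (by linarith)
  have hlx : 0 < log x := log_pos (by linarith)
  have hA : 0 ≤ x * (log x / log z) ^ (-(log x / log z)) := by positivity
  have hS : 0 ≤ √x := sqrt_nonneg x
  rcases le_total (log x / log z) √z with h | h
  · nlinarith [hP x z (by linarith) hzx h, mul_nonneg hC.le hA, mul_nonneg hC.le hS]
  · rw [le_div_iff₀ hL] at h
    obtain ⟨w, hzw, hwx, hw⟩ := exists_sqrt_mul_log_eq (by linarith) hzx h
    have hw0 : 0 < w := by linarith
    have hLw : 0 < log w := log_pos (by linarith)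
    have hu : log x / log w = √w := by rw [← hw]; field_simp
    have h1 := hP x w (by linarith) hwx hu.le
    have h2 : x * √w ^ (-√w) = √x := by
      rw [rpow_def_of_pos (sqrt_pos.2 hw0), log_sqrt hw0.le,
        show log w / 2 * -√w = -(log x / 2) by rw [← hw]; ring, ← log_sqrt hx0.le, exp_neg,
        exp_log (sqrt_pos.2 hx0), ← div_eq_mul_inv, div_sqrt]
    rw [hu, h2] at h1
    have h3 : (Psi x z : ℝ) ≤ Psi x w := by
      exact_mod_cast Psi_mono_right hx0.le (by linarith) hzw
    nlinarith [mul_nonneg hC.le hA]
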